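/- Let N = 2^n with n ≥ 1, let γ = {γ_u} be strictly positive weights, and let z = (z_1,…,z_s) ∈ {1,…,N−1}^s with gcd(z_j, N) = 1 for 1 ≤ j ≤ s. Then T_{1,γ}(N,z) ≤ Σ_{∅≠u⊆{1,…,s}} (γ_u/N)(log 4 + 2(1 + log N))^{|u|} − Σ_{∅≠u⊆{1,…,s}} γ_u (log 4)^{|u|} + Σ_{∅≠u⊆{1,…,s}} (γ_u/N) · 2|u| · (1 + 2 log N)^{|u|} · (1 + log N) + (1/N) H_{s,n,γ}(z). -/

import Mathlib

open Finset MeasureTheory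

noncomputable section

/-- `lsin a = log (1 / sin² (π a))`. -/
def lsin (a : ℝ) : ℝ := Real.log (1 / Real.sin (Real.pi * a) ^ 2)

/-- The support of `m ∈ ℤ^s`, viewed as a subset of `{1,…,s} ⊂ ℕ`
(component `j : Fin s` corresponds to the index `j+1 ∈ {1,…,s}`). -/
def msupp {s : ℕ} (m : Fin s → ℤ) : Finset ℕ :=
  (Finset.univ.filter fun j => m j ≠ 0).image fun j : Fin s => (j : ℕ) + 1

/-- `r_{α,γ}(m) = γ_{supp(m)}⁻¹ ∏_{j ∈ supp(m)} |m_j|^α`. -/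
def rweight {s : ℕ} (α : ℝ) (γ : Finset ℕ → ℝ) (m : Fin s → ℤ) : ℝ :=
  (γ (msupp m))⁻¹ * ∏ j ∈ Finset.univ.filter (fun j => m j ≠ 0), |(m j : ℝ)| ^ α

/-- The truncated quantity
`T_{α,γ}(N,z) = ∑_{m ∈ M_{N,s}\{0}, m·z ≡ 0 (mod N)} 1 / r_{α,γ}(m)`,
where `M_{N,s} = {-(N-1),…,N-1}^s` and the components of `z` are `z 1, …, z s`. -/
def Tsum (α : ℝ) (γ : Finset ℕ → ℝ) (N s : ℕ) (z : ℕ → ℤ) : ℝ :=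
  ∑ m ∈ (Fintype.piFinset fun _ : Fin s => Finset.Icc (-(N : ℤ) + 1) ((N : ℤ) - 1)).filter
      (fun m => m ≠ 0 ∧ (∑ j : Fin s, m j * z ((j : ℕ) + 1)) % (N : ℤ) = 0),
    1 / rweight α γ m

/-- `H_{s,n,γ}(z) = ∑_{k=1}^{2^n-1} ∑_{∅≠u⊆{1,…,s}} γ_u ∏_{j∈u} log(1/sin²(π k z_j/2^n))`. -/
def Hsum (γ : Finset ℕ → ℝ) (s n : ℕ) (z : ℕ → ℤ) : ℝ :=
  ∑ k ∈ Finset.Icc (1:ℕ) (2 ^ n - 1),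
    ∑ u ∈ (Finset.Icc 1 s).powerset.filter (· ≠ ∅),
      γ u * ∏ j ∈ u, lsin ((k : ℝ) * (z j : ℝ) / 2 ^ n)

/-- The digit-wise quality function `h_{r,n,v,γ}(x)` (with previously chosen
components `z 1, …, z (r-1)`). -/
def hqual (γ : Finset ℕ → ℝ) (n v r : ℕ) (z : ℕ → ℤ) (x : ℤ) : ℝ :=
  ∑ t ∈ Finset.Icc v n, (1 / 2 ^ (t - v) : ℝ) *
    ∑ k ∈ (Finset.Icc (1:ℕ) (2 ^ t - 1)).filter (fun k => Odd k),
      ((∑ u ∈ (Finset.Icc 1 (r - 1)).powerset.filter (· ≠ ∅),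
          γ u * ∏ j ∈ u, lsin ((k : ℝ) * (z j : ℝ) / 2 ^ t)) +
        ∑ u ∈ (Finset.Icc 1 (r - 1)).powerset,
          γ (u ∪ {r}) * lsin ((k : ℝ) * (x : ℝ) / 2 ^ v) *
            ∏ j ∈ u, lsin ((k : ℝ) * (z j : ℝ) / 2 ^ t))

/-- `z = (z 1, …, z s)` is (a possible) output of the component-by-component
digit-by-digit construction (Algorithm 1) with inputs `n`, `s` and weights `γ`:
`z 1 = 1`, and for `r = 2,…,s` one has `z_{r,1} = 1` and for `v = 2,…,n`,
`z_{r,v} = z_{r,v-1} + z* 2^{v-1}` where `z* ∈ {0,1}` minimizes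
`z ↦ h_{r,n,v,γ}(z_{r,v-1} + z 2^{v-1})`; finally `z r = z_{r,n}`. -/
def IsCBCDBD (γ : Finset ℕ → ℝ) (n s : ℕ) (z : ℕ → ℤ) : Prop :=
  z 1 = 1 ∧
  ∃ zz : ℕ → ℕ → ℤ,
    ∀ r ∈ Finset.Icc 2 s, zz r 1 = 1 ∧ z r = zz r n ∧
      ∀ v ∈ Finset.Icc 2 n, ∃ zs ∈ ({0, 1} : Set ℤ),
        zz r v = zz r (v - 1) + zs * 2 ^ (v - 1) ∧
        ∀ w ∈ ({0, 1} : Set ℤ),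
          hqual γ n v r z (zz r (v - 1) + zs * 2 ^ (v - 1)) ≤
            hqual γ n v r z (zz r (v - 1) + w * 2 ^ (v - 1))

/-- The weights `γ ∪ v`, i.e. `(γ ∪ v)_u = γ_{u ∪ v}`. -/
def unionWeights (γ : Finset ℕ → ℝ) (v : Finset ℕ) : Finset ℕ → ℝ :=
  fun u => γ (u ∪ v)

/-- `γ̃_j = max_{v ⊆ {1,…,j-1}} γ_{v ∪ {j}} / γ_v`. -/
def tildeW (γ : Finset ℕ → ℝ) (j : ℕ) : ℝ :=
  (Finset.Icc 1 (j - 1)).powerset.sup' ⟨∅, Finset.empty_mem_powerset _⟩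
    fun v => γ (insert j v) / γ v

/-- The unit cube `[0,1]^s`. -/
def cube (s : ℕ) : Set (Fin s → ℝ) := Set.univ.pi fun _ => Set.Icc 0 1

/-- The Fourier coefficient `f̂(m) = ∫_{[0,1]^s} f(x) e^{-2πi m·x} dx`. -/
def fcoeff (s : ℕ) (f : (Fin s → ℝ) → ℂ) (m : Fin s → ℤ) : ℂ :=
  ∫ x in cube s,
    f x * Complex.exp (-(2 * (Real.pi : ℂ) * Complex.I) * ∑ j, (m j : ℂ) * (x j : ℂ))

/-- The rank-1 lattice rule `Q_{N,s}(f,z) = (1/N) ∑_{k=0}^{N-1} f({k z / N})`. -/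
def qmc (N s : ℕ) (z : ℕ → ℤ) (f : (Fin s → ℝ) → ℂ) : ℂ :=
  (N : ℂ)⁻¹ * ∑ k ∈ Finset.range N,
    f fun j => Int.fract ((k : ℝ) * (z ((j : ℕ) + 1) : ℝ) / (N : ℝ))

/-- The worst-case error `e_{N,s,α,γ}(z)` of the rank-1 lattice rule with generating
vector `z` in the unit ball of the space `E^α_{s,γ}` (whose elements are identified
with their continuous representatives). -/
def wce (N s : ℕ) (α : ℝ) (γ : Finset ℕ → ℝ) (z : ℕ → ℤ) : ℝ :=
  ⨆ f ∈ {f : (Fin s → ℝ) → ℂ |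
      Continuous f ∧ ∀ m : Fin s → ℤ, ‖fcoeff s f m‖ * rweight α γ m ≤ 1},
    ‖(∫ x in cube s, f x) - qmc N s z f‖

/-- For POD weights given by `(Γ_ℓ)` and `(γ_j)`:
`p_{m,ℓ,t}(k) = ∑_{u ⊆ {1,…,m}, |u| = ℓ} Γ_ℓ ∏_{j∈u} γ_j log(1/sin²(π k z_j/2^t))`. -/
def psum (Γ γw : ℕ → ℝ) (z : ℕ → ℤ) (m ℓ t : ℕ) (k : ℕ) : ℝ :=
  ∑ u ∈ (Finset.Icc 1 m).powerset.filter (fun u => u.card = ℓ),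
    Γ ℓ * ∏ j ∈ u, γw j * lsin ((k : ℝ) * (z j : ℝ) / 2 ^ t)

def auxF (N : ℕ) (w : ℂ) : ℂ := ∑ m ∈ range N, w ^ m / (m : ℂ)

def auxE (x : ℝ) : ℂ := Complex.exp ((2 * Real.pi * x : ℝ) * Complex.I)

def auxA (N : ℕ) (x : ℝ) : ℝ := Real.log 4 + 2 * (auxF N (auxE x)).re

lemma auxF_step (N : ℕ) (hN : 1 ≤ N) (w : ℂ) (hw : ‖w‖ = 1) (M : ℕ) (hM : N ≤ M) :
    ‖(1 - w) * (auxF M w - auxF N w) + w ^ M / (M : ℂ)‖ ≤ 2 / (N : ℝ) - 1 / (M : ℝ) := by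
  induction M, hM using Nat.le_induction with
  | base =>
    simp only [sub_self, mul_zero, zero_add, norm_div, norm_pow, hw, one_pow, Complex.norm_natCast]
    apply le_of_eq; ring
  | succ M hM ih =>
    have hM0 : (0:ℝ) < M := by exact_mod_cast (by omega : 0 < M)
    have hMc : (M:ℂ) ≠ 0 := by exact_mod_cast (by omega : M ≠ 0)
    have hMc1 : (M:ℂ) + 1 ≠ 0 := by exact_mod_cast (by omega : M + 1 ≠ 0)
    have e1 : (1 - w) * (auxF (M+1) w - auxF N w) + w ^ (M+1) / ((M+1 : ℕ) : ℂ)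
        = ((1 - w) * (auxF M w - auxF N w) + w ^ M / (M : ℂ))
          + w ^ (M+1) * (((1 / ((M:ℝ)+1) - 1 / (M:ℝ) : ℝ)) : ℂ) := by
      unfold auxF
      rw [sum_range_succ]
      push_cast
      field_simp
      ring
    have e2 : ‖w ^ (M+1) * (((1 / ((M:ℝ)+1) - 1 / (M:ℝ) : ℝ)) : ℂ)‖ = 1 / (M:ℝ) - 1 / ((M:ℝ)+1) := by
      rw [norm_mul, norm_pow, hw, one_pow, one_mul, Complex.norm_real, Real.norm_eq_abs, abs_sub_comm, abs_of_nonneg]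
      rw [sub_nonneg]
      exact one_div_le_one_div_of_le hM0 (by linarith)
    rw [e1]
    refine (norm_add_le _ _).trans ?_
    rw [e2]
    push_cast
    linarith

lemma auxF_sub (N : ℕ) (hN : 1 ≤ N) (w : ℂ) (hw : ‖w‖ = 1) (hw1 : w ≠ 1) (M : ℕ) (hM : N ≤ M) :
    ‖auxF M w - auxF N w‖ ≤ 2 / (N * ‖1 - w‖) := by
  have h := auxF_step N hN w hw M hM
  have hpos : 0 < ‖1 - w‖ := norm_pos_iff.2 (sub_ne_zero.2 (Ne.symm hw1))
  have h2 : ‖w ^ M / (M : ℂ)‖ = 1 / M := by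
    simp [norm_pow, hw]
  have h3 : ‖(1 - w) * (auxF M w - auxF N w)‖ ≤ 2 / N := by
    have := norm_sub_le ((1 - w) * (auxF M w - auxF N w) + w ^ M / (M : ℂ)) (w ^ M / (M : ℂ))
    rw [add_sub_cancel_right, h2] at this
    linarith
  rw [norm_mul] at h3
  rw [← div_div, le_div_iff₀ hpos]
  linarith

lemma auxF_tendsto (w : ℂ) (hw : ‖w‖ = 1) (hw1 : w ≠ 1) :
    Filter.Tendsto (fun M => auxF M w) Filter.atTop (nhds (-Complex.log (1 - w))) := by
  have hpos : 0 < ‖1 - w‖ := norm_pos_iff.2 (sub_ne_zero.2 (Ne.symm hw1))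
  have hc : CauchySeq (fun M => auxF M w) := by
    rw [Metric.cauchySeq_iff']
    intro ε hε
    obtain ⟨N, hN⟩ := exists_nat_gt (2 / (ε * ‖1 - w‖))
    refine ⟨N + 1, fun M hM => ?_⟩
    rw [dist_eq_norm]
    refine (auxF_sub (N+1) (by omega) w hw hw1 M hM).trans_lt ?_
    rw [div_lt_iff₀ (by positivity)] at hN
    rw [div_lt_iff₀ (by positivity)]
    push_cast
    nlinarith [mul_pos hε hpos]
  obtain ⟨l, hl⟩ := cauchySeq_tendsto_of_complete hc
  have habel := Complex.tendsto_tsum_powerSeries_nhdsWithin_lt hl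
  rw [Filter.tendsto_map'_iff] at habel
  have hslit : 1 - w ∈ Complex.slitPlane := by
    left
    simp only [Complex.sub_re, Complex.one_re, sub_pos]
    have h1 : w.re ≤ 1 := by rw [← hw]; exact Complex.re_le_norm w
    refine lt_of_le_of_ne h1 fun h => hw1 ?_
    have h2 : Complex.normSq w = 1 := by rw [Complex.normSq_eq_norm_sq, hw]; norm_num
    rw [Complex.normSq_apply, h] at h2
    apply Complex.ext
    · simpa using h
    · simp; nlinarith
  have hlim2 : Filter.Tendsto (fun r : ℝ => -Complex.log (1 - w * (r:ℂ))) (nhdsWithin 1 (Set.Iio 1))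
      (nhds (-Complex.log (1 - w))) := by
    have : ContinuousAt (fun r : ℝ => -Complex.log (1 - w * (r:ℂ))) 1 := by
      apply ContinuousAt.neg
      apply ContinuousAt.clog
      · fun_prop
      · simpa using hslit
    have h := this.tendsto
    simp only [Complex.ofReal_one, mul_one] at h
    exact h.mono_left nhdsWithin_le_nhds
  have heq : l = -Complex.log (1 - w) := by
    refine tendsto_nhds_unique habel (hlim2.congr' ?_)
    have : Set.Ioo (0:ℝ) 1 ∈ nhdsWithin (1:ℝ) (Set.Iio 1) := Ioo_mem_nhdsLT (by norm_num)
    filter_upwards [this] with r hr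
    have hn : ‖w * (r:ℂ)‖ < 1 := by
      rw [norm_mul, hw, one_mul, Complex.norm_real, Real.norm_eq_abs, abs_of_pos hr.1]; exact hr.2
    have := (Complex.hasSum_taylorSeries_neg_log hn).tsum_eq
    rw [← this]
    simp only [Function.comp]
    apply tsum_congr
    intro b
    rw [mul_pow]; ring
  rw [← heq]; exact hl

lemma auxF_bound (N : ℕ) (hN : 1 ≤ N) (w : ℂ) (hw : ‖w‖ = 1) (hw1 : w ≠ 1) :
    ‖-Complex.log (1 - w) - auxF N w‖ ≤ 2 / (N * ‖1 - w‖) := by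
  have h := ((auxF_tendsto w hw hw1).sub_const (auxF N w)).norm
  refine le_of_tendsto h ?_
  filter_upwards [Filter.eventually_ge_atTop N] with M hM
  exact auxF_sub N hN w hw hw1 M hM

lemma auxE_norm (x : ℝ) : ‖auxE x‖ = 1 := Complex.norm_exp_ofReal_mul_I _

lemma auxE_one_sub (x : ℝ) : ‖1 - auxE x‖ = 2 * |Real.sin (Real.pi * x)| := by
  have h : ‖1 - auxE x‖ ^ 2 = (2 * |Real.sin (Real.pi * x)|) ^ 2 := by
    rw [← Complex.normSq_eq_norm_sq, mul_pow, sq_abs, Complex.normSq_apply, auxE]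
    simp only [Complex.sub_re, Complex.one_re, Complex.exp_ofReal_mul_I_re, Complex.sub_im, Complex.one_im,
      Complex.exp_ofReal_mul_I_im]
    rw [mul_assoc 2, Real.cos_two_mul, Real.sin_two_mul]
    have := Real.sin_sq_add_cos_sq (Real.pi * x)
    have h2 : Real.cos (Real.pi * x) ^ 2 = 1 - Real.sin (Real.pi * x) ^ 2 := by linarith
    ring_nf
    have h4 : Real.cos (Real.pi * x) ^ 4 = (1 - Real.sin (Real.pi * x) ^ 2)^2 := by rw [← h2]; ring
    rw [h4, h2]; ring
  exact (sq_eq_sq₀ (norm_nonneg _) (by positivity)).1 h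

lemma auxA_bound (N : ℕ) (hN : 1 ≤ N) (x : ℝ) (hx : Real.sin (Real.pi * x) ≠ 0) :
    |auxA N x - lsin x| ≤ 2 / (N * |Real.sin (Real.pi * x)|) := by
  have hp : 0 < |Real.sin (Real.pi * x)| := abs_pos.2 hx
  have hE := auxE_one_sub x
  have h1 : auxE x ≠ 1 := by
    intro h
    rw [h] at hE
    simp at hE
    exact hx hE
  have hb := auxF_bound N hN (auxE x) (auxE_norm x) h1
  have hr := (Complex.abs_re_le_norm _).trans hb
  rw [Complex.sub_re, Complex.neg_re, Complex.log_re, hE, Real.log_mul (by norm_num) hp.ne', Real.log_abs] at hr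
  have hl : lsin x = Real.log 4 + 2 * (-(Real.log 2 + Real.log (Real.sin (Real.pi * x)))) := by
    unfold lsin
    rw [one_div, Real.log_inv, Real.log_pow, show (4:ℝ) = 2 ^ 2 by norm_num, Real.log_pow]
    push_cast; ring
  have : auxA N x - lsin x = -(2 * (-(Real.log 2 + Real.log (Real.sin (Real.pi * x))) - (auxF N (auxE x)).re)) := by
    rw [hl, auxA]; ring
  rw [this, abs_neg, abs_mul, abs_two]
  calc _ ≤ 2 * (2 / (N * (2 * |Real.sin (Real.pi * x)|))) := by gcongr
    _ = _ := by field_simp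

lemma abs_sin_mod (N : ℕ) (hN : 1 ≤ N) (a : ℤ) :
    |Real.sin (Real.pi * ((a:ℝ) / N))| = |Real.sin (Real.pi * (((a % (N:ℤ) : ℤ) : ℝ) / N))| := by
  have hN0 : (N:ℝ) ≠ 0 := by exact_mod_cast (by omega : N ≠ 0)
  have h : (a:ℝ) = ((a % (N:ℤ) : ℤ) : ℝ) + N * ((a / (N:ℤ) : ℤ) : ℝ) := by
    exact_mod_cast (Int.emod_add_mul_ediv a N).symm
  have h2 : Real.pi * ((a:ℝ) / N) = Real.pi * (((a % (N:ℤ) : ℤ) : ℝ) / N) + ((a / (N:ℤ) : ℤ) : ℝ) * Real.pi := by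
    conv_lhs => rw [h]
    field_simp
  rw [h2, Real.sin_add_int_mul_pi, abs_mul, abs_zpow]
  simp

lemma sin_lower (N r : ℕ) (h1 : 1 ≤ r) (h2 : r < N) :
    2 / N ≤ |Real.sin (Real.pi * ((r:ℝ) / N))| ∧
    2 / (N * |Real.sin (Real.pi * ((r:ℝ) / N))|) ≤ 1 / (r:ℝ) + 1 / ((N - r : ℕ) : ℝ) := by
  have hN0 : (0:ℝ) < N := by exact_mod_cast (by omega : 0 < N)
  have key : ∀ q : ℕ, 1 ≤ q → 2 * q ≤ N → 2 * q / (N:ℝ) ≤ Real.sin (Real.pi * ((q:ℝ) / N)) := by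
    intro q hq hqN
    have hqN' : 2 * (q:ℝ) ≤ N := by exact_mod_cast hqN
    have := Real.mul_le_sin (x := Real.pi * ((q:ℝ) / N)) (by positivity) (by
      have : (q:ℝ) / N ≤ 1 / 2 := by rw [div_le_div_iff₀ hN0 (by norm_num)]; linarith
      nlinarith [Real.pi_pos])
    refine le_trans (le_of_eq ?_) this
    field_simp
  have concl : ∀ q : ℕ, 1 ≤ q → 2 * q / (N:ℝ) ≤ |Real.sin (Real.pi * ((r:ℝ) / N))| →
     2 / N ≤ |Real.sin (Real.pi * ((r:ℝ) / N))| ∧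
    2 / (N * |Real.sin (Real.pi * ((r:ℝ) / N))|) ≤ 1 / (q:ℝ) := by
    intro q hq h
    have hq1 : (1:ℝ) ≤ q := by exact_mod_cast hq
    constructor
    · refine le_trans ?_ h
      gcongr; linarith
    · have hs : 0 < |Real.sin (Real.pi * ((r:ℝ) / N))| := lt_of_lt_of_le (by positivity) h
      rw [div_le_div_iff₀ (by positivity) (by positivity)]
      rw [div_le_iff₀ hN0] at h
      linarith
  by_cases hc : 2 * r ≤ N
  · obtain ⟨a, b⟩ := concl r h1 ((key r h1 hc).trans (le_abs_self _))
    exact ⟨a, b.trans (le_add_of_nonneg_right (by positivity))⟩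
  · have hk := key (N - r) (by omega) (by omega)
    have he : Real.sin (Real.pi * (((N - r : ℕ):ℝ) / N)) = Real.sin (Real.pi * ((r:ℝ) / N)) := by
      rw [← Real.sin_pi_sub]
      congr 1
      rw [Nat.cast_sub h2.le]
      field_simp
      ring
    rw [he] at hk
    obtain ⟨a, b⟩ := concl (N - r) (by omega) (hk.trans (le_abs_self _))
    exact ⟨a, b.trans (le_add_of_nonneg_left (by positivity))⟩

lemma modfacts (N : ℕ) (hN : 1 ≤ N) (a : ℤ) (ha : a % (N:ℤ) ≠ 0) :
    ∃ r : ℕ, 1 ≤ r ∧ r < N ∧ ((r : ℤ) = a % (N:ℤ)) := by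
  have h0 := Int.emod_nonneg a (b := N) (by omega)
  have h1 := Int.emod_lt_of_pos a (b := N) (by omega)
  exact ⟨(a % (N:ℤ)).toNat, by omega, by omega, by omega⟩

lemma bounds (N : ℕ) (hN : 1 ≤ N) (a : ℤ) (ha : a % (N:ℤ) ≠ 0) :
    |lsin ((a:ℝ) / N)| ≤ 1 + 2 * Real.log N ∧ |auxA N ((a:ℝ) / N)| ≤ 1 + 2 * Real.log N ∧
    |auxA N ((a:ℝ) / N) - lsin ((a:ℝ) / N)| ≤
      1 / (((a % (N:ℤ)).toNat : ℕ) : ℝ) + 1 / ((N - (a % (N:ℤ)).toNat : ℕ) : ℝ) := by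
  obtain ⟨r, h1, h2, h3⟩ := modfacts N hN a ha
  have hN0 : (0:ℝ) < N := by exact_mod_cast (by omega : 0 < N)
  have hs := abs_sin_mod N hN a
  obtain ⟨l1, l2⟩ := sin_lower N r h1 h2
  rw [← h3, Int.toNat_natCast]
  rw [← h3] at hs
  simp only [Int.cast_natCast] at hs
  rw [← hs] at l1 l2
  have hpos : 0 < |Real.sin (Real.pi * ((a:ℝ) / N))| := lt_of_lt_of_le (by positivity) l1
  have hA := auxA_bound N hN ((a:ℝ)/N) (abs_pos.1 hpos)
  have hR1 : |auxA N ((a:ℝ) / N) - lsin ((a:ℝ) / N)| ≤ 1 := by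
    refine hA.trans ?_
    rw [div_le_one (by positivity)]
    rw [div_le_iff₀ hN0] at l1
    linarith
  have hls : lsin ((a:ℝ) / N) = - (2 * Real.log |Real.sin (Real.pi * ((a:ℝ) / N))|) := by
    unfold lsin
    rw [one_div, Real.log_inv, Real.log_pow, Real.log_abs]
    push_cast; ring
  have hlo : 0 ≤ lsin ((a:ℝ) / N) := by
    rw [hls]
    have := Real.log_nonpos hpos.le (Real.abs_sin_le_one _)
    linarith
  have hhi : lsin ((a:ℝ) / N) ≤ 2 * Real.log N := by
    rw [hls]
    have := Real.log_le_log (by positivity) l1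
    rw [Real.log_div (by norm_num) hN0.ne'] at this
    have := Real.log_pos (one_lt_two)
    linarith
  refine ⟨?_, ?_, hA.trans l2⟩
  · rw [abs_of_nonneg hlo]; linarith
  · rw [abs_le] at *
    constructor <;> linarith [hR1.1, hR1.2]

lemma harm (N : ℕ) (hN : 1 ≤ N) : ∑ r ∈ Icc 1 (N - 1), 1 / (r : ℝ) ≤ 1 + Real.log N := by
  have h := harmonic_le_one_add_log (N - 1)
  rw [harmonic_eq_sum_Icc] at h
  push_cast at h
  simp only [one_div]
  refine h.trans ?_
  by_cases h1 : N = 1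
  · simp [h1]
  · have : (0:ℝ) < ((N - 1 : ℕ) : ℝ) := by exact_mod_cast (by omega : 0 < N - 1)
    have := Real.log_le_log this (by exact_mod_cast (by omega : N - 1 ≤ N) : ((N - 1 : ℕ) : ℝ) ≤ N)
    linarith

lemma harm2 (N : ℕ) (hN : 1 ≤ N) :
    ∑ r ∈ Icc 1 (N - 1), (1 / (r : ℝ) + 1 / ((N - r : ℕ) : ℝ)) ≤ 2 * (1 + Real.log N) := by
  rw [sum_add_distrib]
  have : ∑ r ∈ Icc 1 (N - 1), 1 / ((N - r : ℕ) : ℝ) = ∑ r ∈ Icc 1 (N - 1), 1 / (r : ℝ) := by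
    apply sum_nbij' (fun r => N - r) (fun r => N - r)
    · intro a ha; simp at *; omega
    · intro a ha; simp at *; omega
    · intro a ha; simp at *; omega
    · intro a ha; simp at *; omega
    · intro a ha; rfl
  rw [this]
  linarith [harm N hN]

lemma cop_ne (N : ℕ) (z : ℤ) (hz : IsCoprime z (N:ℤ)) (k : ℕ) (hk : k ∈ Icc 1 (N-1)) :
    ((k:ℤ) * z) % (N:ℤ) ≠ 0 := by
  intro h
  have h1 := Int.dvd_of_emod_eq_zero h
  have h2 := hz.symm.dvd_of_dvd_mul_right h1
  simp at hk
  have := Int.le_of_dvd (by omega) h2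
  omega

lemma sumR (N : ℕ) (hN : 1 ≤ N) (z : ℤ) (hz : IsCoprime z (N:ℤ)) :
    ∑ k ∈ Icc 1 (N-1), |auxA N ((k:ℝ) * z / N) - lsin ((k:ℝ) * z / N)| ≤ 2 * (1 + Real.log N) := by
  refine le_trans ?_ (harm2 N hN)
  have hinj : Set.InjOn (fun k : ℕ => (((k:ℤ) * z) % (N:ℤ)).toNat) (Icc 1 (N-1) : Finset ℕ) := by
    intro a ha b hb hab
    simp only [coe_Icc, Set.mem_Icc] at ha hb
    have h0 := Int.emod_nonneg ((a:ℤ)*z) (b := N) (by omega)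
    have h0' := Int.emod_nonneg ((b:ℤ)*z) (b := N) (by omega)
    have hab' : ((a:ℤ)*z) % (N:ℤ) = ((b:ℤ)*z) % (N:ℤ) := by simp only at hab; omega
    have h2 := Int.dvd_of_emod_eq_zero (Int.emod_eq_emod_iff_emod_sub_eq_zero.1 hab')
    rw [← sub_mul] at h2
    have h3 := hz.symm.dvd_of_dvd_mul_right h2
    have h4 := Int.eq_zero_of_abs_lt_dvd h3 (by rw [abs_lt]; omega)
    omega
  calc _ ≤ ∑ k ∈ Icc 1 (N-1), (fun r : ℕ => 1 / (r : ℝ) + 1 / ((N - r : ℕ) : ℝ)) ((((k:ℤ) * z) % (N:ℤ)).toNat) := by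
        apply sum_le_sum
        intro k hk
        have := (bounds N hN ((k:ℤ)*z) (cop_ne N z hz k hk)).2.2
        push_cast at this
        exact this
    _ = ∑ r ∈ (Icc 1 (N-1)).image (fun k : ℕ => (((k:ℤ) * z) % (N:ℤ)).toNat), (1 / (r : ℝ) + 1 / ((N - r : ℕ) : ℝ)) := by
        rw [sum_image hinj]
    _ ≤ _ := by
        apply sum_le_sum_of_subset_of_nonneg
        · intro r hr
          obtain ⟨k, hk, rfl⟩ := mem_image.1 hr
          obtain ⟨q, q1, q2, q3⟩ := modfacts N hN _ (cop_ne N z hz k hk)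
          simp only [mem_Icc]
          omega
        · intros; positivity

lemma prod_diff {ι : Type*} [DecidableEq ι] (u : Finset ι) (a b : ι → ℝ) (C : ℝ) (hC : 1 ≤ C)
    (ha : ∀ j ∈ u, |a j| ≤ C) (hb : ∀ j ∈ u, |b j| ≤ C) :
    ∏ j ∈ u, a j - ∏ j ∈ u, b j ≤ C ^ u.card * ∑ j ∈ u, |a j - b j| := by
  have : |∏ j ∈ u, a j - ∏ j ∈ u, b j| ≤ C ^ u.card * ∑ j ∈ u, |a j - b j| := by
    induction u using Finset.induction_on with
    | empty => simp
    | insert i u hi ih =>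
      rw [prod_insert hi, prod_insert hi, card_insert_of_notMem hi, sum_insert hi]
      have ih' := ih (fun j hj => ha j (mem_insert_of_mem hj)) (fun j hj => hb j (mem_insert_of_mem hj))
      have hpb : |∏ j ∈ u, b j| ≤ C ^ u.card := by
        rw [abs_prod]
        rw [← prod_const]
        exact prod_le_prod (fun _ _ => abs_nonneg _) (fun j hj => hb j (mem_insert_of_mem hj))
      have e : a i * ∏ j ∈ u, a j - b i * ∏ j ∈ u, b j
          = a i * (∏ j ∈ u, a j - ∏ j ∈ u, b j) + (a i - b i) * ∏ j ∈ u, b j := by ring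
      rw [e]
      refine (abs_add_le _ _).trans ?_
      rw [abs_mul, abs_mul]
      have h1 : |a i| * |∏ j ∈ u, a j - ∏ j ∈ u, b j| ≤ C * (C ^ u.card * ∑ j ∈ u, |a j - b j|) :=
        mul_le_mul (ha i (mem_insert_self _ _)) ih' (abs_nonneg _) (by linarith)
      have h2 : |a i - b i| * |∏ j ∈ u, b j| ≤ |a i - b i| * C ^ (u.card + 1) := by
        gcongr
        exact hpb.trans (pow_le_pow_right₀ hC (Nat.le_succ _))
      calc _ ≤ _ := add_le_add h1 h2
        _ = _ := by ring
  exact (le_abs_self _).trans this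

lemma sum_diff (N : ℕ) (hN : 1 ≤ N) (z : ℕ → ℤ) (u : Finset ℕ) (hz : ∀ j ∈ u, IsCoprime (z j) (N:ℤ)) :
    ∑ k ∈ Icc 1 (N-1), ∏ j ∈ u, auxA N ((k:ℝ) * z j / N) ≤
      ∑ k ∈ Icc 1 (N-1), ∏ j ∈ u, lsin ((k:ℝ) * z j / N)
      + 2 * u.card * (1 + 2 * Real.log N) ^ u.card * (1 + Real.log N) := by
  have hL : 0 ≤ Real.log N := Real.log_natCast_nonneg N
  rw [← sub_le_iff_le_add', ← sum_sub_distrib]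
  calc _ ≤ ∑ k ∈ Icc 1 (N-1), (1 + 2 * Real.log N) ^ u.card * ∑ j ∈ u, |auxA N ((k:ℝ) * z j / N) - lsin ((k:ℝ) * z j / N)| := by
        apply sum_le_sum
        intro k hk
        apply prod_diff _ _ _ _ (by linarith)
        · intro j hj
          have := (bounds N hN ((k:ℤ)*z j) (cop_ne N (z j) (hz j hj) k hk)).2.1
          push_cast at this
          exact this
        · intro j hj
          have := (bounds N hN ((k:ℤ)*z j) (cop_ne N (z j) (hz j hj) k hk)).1
          push_cast at this
          exact this
    _ = (1 + 2 * Real.log N) ^ u.card * ∑ j ∈ u, ∑ k ∈ Icc 1 (N-1), |auxA N ((k:ℝ) * z j / N) - lsin ((k:ℝ) * z j / N)| := by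
        rw [← mul_sum, sum_comm]
    _ ≤ (1 + 2 * Real.log N) ^ u.card * ∑ j ∈ u, 2 * (1 + Real.log N) := by
        gcongr with j hj
        exact sumR N hN (z j) (hz j hj)
    _ = _ := by
        rw [sum_const, nsmul_eq_mul]; ring

lemma auxE_add (x y : ℝ) : auxE (x + y) = auxE x * auxE y := by
  unfold auxE
  rw [← Complex.exp_add]
  congr 1
  push_cast; ring

lemma auxE_zero : auxE 0 = 1 := by simp [auxE]

lemma auxE_nat_mul (k : ℕ) (x : ℝ) : auxE (k * x) = auxE x ^ k := by
  induction k with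
  | zero => simp [auxE_zero]
  | succ k ih =>
    rw [pow_succ, ← ih, ← auxE_add]
    congr 1
    push_cast; ring

lemma auxE_int (a : ℤ) : auxE a = 1 := by
  unfold auxE
  rw [Complex.exp_eq_one_iff]
  exact ⟨a, by push_cast; ring⟩

lemma auxE_sum {ι : Type*} (t : Finset ι) (f : ι → ℝ) : auxE (∑ i ∈ t, f i) = ∏ i ∈ t, auxE (f i) := by
  classical
  induction t using Finset.induction_on with
  | empty => simp [auxE_zero]
  | insert i t hi ih => rw [sum_insert hi, prod_insert hi, auxE_add, ih]

lemma auxE_orth (N : ℕ) (hN : 1 ≤ N) (a : ℤ) :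
    ∑ k ∈ range N, auxE (k * ((a:ℝ) / N)) = if a % (N:ℤ) = 0 then (N:ℂ) else 0 := by
  have hN0 : (N:ℝ) ≠ 0 := by exact_mod_cast (by omega : N ≠ 0)
  simp only [auxE_nat_mul]
  split_ifs with h
  · obtain ⟨c, rfl⟩ := Int.dvd_of_emod_eq_zero h
    have : auxE ((((N:ℤ) * c : ℤ) : ℝ) / N) = 1 := by
      rw [← auxE_int c]
      congr 1
      push_cast
      field_simp
    simp only [this, one_pow, sum_const, card_range, nsmul_eq_mul, mul_one]
  · have hne : auxE ((a:ℝ) / N) ≠ 1 := by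
      intro h1
      have h2 := auxE_one_sub ((a:ℝ)/N)
      rw [h1, sub_self, norm_zero, abs_sin_mod N hN a] at h2
      obtain ⟨r, r1, r2, r3⟩ := modfacts N hN a h
      have := (sin_lower N r r1 r2).1
      rw [← r3] at h2
      simp only [Int.cast_natCast] at h2
      have hp : (0:ℝ) < 2 / N := by positivity
      linarith
    rw [geom_sum_eq hne, ← auxE_nat_mul, mul_div_cancel₀ _ hN0, auxE_int]
    simp

def auxb (m : ℤ) : ℝ := if m = 0 then Real.log 4 else 1 / |(m:ℝ)|

lemma auxb_nonneg (m : ℤ) : 0 ≤ auxb m := by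
  unfold auxb
  split_ifs
  · exact Real.log_nonneg (by norm_num)
  · positivity

lemma auxA_eq (N : ℕ) (hN : 1 ≤ N) (x : ℝ) :
    ∑ m ∈ Icc (-(N:ℤ) + 1) ((N:ℤ) - 1), (auxb m : ℂ) * auxE (m * x) = (auxA N x : ℂ) := by
  induction N, hN using Nat.le_induction with
  | base => simp [auxb, auxA, auxF, auxE_zero]
  | succ N hN ih =>
    have hI : Icc (-((N+1 : ℕ):ℤ) + 1) (((N+1 : ℕ):ℤ) - 1)
        = insert (N:ℤ) (insert (-(N:ℤ)) (Icc (-(N:ℤ) + 1) ((N:ℤ) - 1))) := by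
      ext m
      simp only [mem_Icc, mem_insert]
      push_cast
      omega
    rw [hI, sum_insert, sum_insert, ih]
    · have hb1 : auxb (N:ℤ) = 1 / N := by
        have : (N:ℤ) ≠ 0 := by omega
        simp [auxb, this]
        omega
      have hb2 : auxb (-(N:ℤ)) = 1 / N := by
        have : (N:ℤ) ≠ 0 := by omega
        simp [auxb, this]
        omega
      have hA : auxA (N+1) x = auxA N x + 2 * (Real.cos (2 * Real.pi * (N * x)) / N) := by
        unfold auxA auxF
        rw [sum_range_succ, Complex.add_re, ← auxE_nat_mul, Complex.div_natCast_re]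
        have hre : (auxE ((N:ℝ) * x)).re = Real.cos (2 * Real.pi * (N * x)) := by
          rw [auxE, Complex.exp_ofReal_mul_I_re]
        rw [hre]
        ring
      have hE : auxE ((N:ℝ) * x) + auxE (-(N:ℝ) * x) = ((2 * Real.cos (2 * Real.pi * (N * x)) : ℝ) : ℂ) := by
        unfold auxE
        push_cast
        rw [Complex.two_cos]
        congr 2 <;> ring
      rw [hb1, hb2, hA]
      push_cast at hE ⊢
      rw [← add_assoc, ← mul_add, hE]
      ring
    · simp
    · simp only [mem_insert, mem_Icc]; omega

def auxB {s : ℕ} (v : Finset (Fin s)) (j : Fin s) (m : ℤ) : ℝ :=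
  if j ∈ v then auxb m else if m = 0 then 1 else 0

lemma auxB_nonneg {s : ℕ} (v : Finset (Fin s)) (j : Fin s) (m : ℤ) : 0 ≤ auxB v j m := by
  unfold auxB
  split_ifs
  · exact auxb_nonneg m
  · norm_num
  · norm_num

lemma count {s : ℕ} (N : ℕ) (hN : 1 ≤ N) (v : Finset (Fin s)) (ζ : Fin s → ℤ) :
    ∑ m ∈ (Fintype.piFinset fun _ : Fin s => Finset.Icc (-(N : ℤ) + 1) ((N : ℤ) - 1)).filter
      (fun m => (∑ j : Fin s, m j * ζ j) % (N : ℤ) = 0), ∏ j, auxB v j (m j)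
    = (1 / (N:ℝ)) * ∑ k ∈ range N, ∏ j ∈ v, auxA N ((k:ℝ) * ζ j / N) := by
  have hN0 : (N:ℂ) ≠ 0 := by exact_mod_cast (by omega : N ≠ 0)
  have hin : ∀ (k : ℕ) (j : Fin s), ∑ m ∈ Finset.Icc (-(N : ℤ) + 1) ((N : ℤ) - 1),
      (auxB v j m : ℂ) * auxE (m * ((k:ℝ) * ζ j / N))
      = if j ∈ v then (auxA N ((k:ℝ) * ζ j / N) : ℂ) else 1 := by
    intro k j
    split_ifs with hj
    · rw [← auxA_eq N hN]
      simp [auxB, hj]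
    · rw [sum_eq_single 0]
      · simp [auxB, hj, auxE_zero]
      · intro m _ hm
        simp [auxB, hj, hm]
      · intro h
        exact absurd (by simp only [mem_Icc]; omega) h
  have hk : ∀ k : ℕ, ((∏ j ∈ v, auxA N ((k:ℝ) * ζ j / N) : ℝ) : ℂ)
      = ∑ m ∈ Fintype.piFinset fun _ : Fin s => Finset.Icc (-(N : ℤ) + 1) ((N : ℤ) - 1),
        (∏ j, (auxB v j (m j) : ℂ)) * auxE (k * (((∑ j, m j * ζ j : ℤ) : ℝ) / N)) := by
    intro k
    have h1 : ((∏ j ∈ v, auxA N ((k:ℝ) * ζ j / N) : ℝ) : ℂ)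
        = ∏ j, ∑ m ∈ Finset.Icc (-(N : ℤ) + 1) ((N : ℤ) - 1),
      (auxB v j m : ℂ) * auxE (m * ((k:ℝ) * ζ j / N)) := by
      simp only [hin]
      rw [prod_ite_mem, univ_inter]
      push_cast
      rfl
    rw [h1, prod_univ_sum]
    apply sum_congr rfl
    intro m _
    rw [prod_mul_distrib, ← auxE_sum]
    congr 2
    push_cast
    rw [sum_div, mul_sum]
    apply sum_congr rfl
    intros; ring
  have : (((∑ m ∈ (Fintype.piFinset fun _ : Fin s => Finset.Icc (-(N : ℤ) + 1) ((N : ℤ) - 1)).filter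
      (fun m => (∑ j : Fin s, m j * ζ j) % (N : ℤ) = 0), ∏ j, auxB v j (m j) : ℝ)) : ℂ)
    = (((1 / (N:ℝ)) * ∑ k ∈ range N, ∏ j ∈ v, auxA N ((k:ℝ) * ζ j / N) : ℝ) : ℂ) := by
    rw [Complex.ofReal_mul, Complex.ofReal_sum (range N)]
    simp only [hk]
    rw [sum_comm]
    simp only [← mul_sum, auxE_orth N hN]
    rw [sum_filter]
    push_cast
    rw [mul_sum]
    apply sum_congr rfl
    intro m _
    split_ifs
    · field_simp
      push_cast
      rfl
    · simp
  exact_mod_cast this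

lemma auxA_zero (N : ℕ) (hN : 1 ≤ N) : 0 ≤ auxA N 0 ∧ auxA N 0 ≤ Real.log 4 + 2 * (1 + Real.log N) := by
  have h : (auxF N (auxE 0)).re = ∑ r ∈ Icc 1 (N - 1), 1 / (r:ℝ) := by
    unfold auxF
    rw [auxE_zero, Complex.re_sum]
    symm
    apply sum_subset_zero_on_sdiff
    · intro r hr; simp at *; omega
    · intro r hr
      have : r = 0 := by simp at hr; omega
      simp [this]
    · intro r _
      rw [one_pow, Complex.div_natCast_re, Complex.one_re]
  unfold auxA
  rw [h]
  constructor
  · have : 0 ≤ Real.log 4 := Real.log_nonneg (by norm_num)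
    positivity
  · linarith [harm N hN]

lemma per_u (N : ℕ) (hN : 1 ≤ N) (s : ℕ) (z : ℕ → ℤ) (u : Finset ℕ) (hu : u ⊆ Icc 1 s) (hne : u ≠ ∅)
    (hz : ∀ j ∈ u, IsCoprime (z j) (N:ℤ)) :
    ∑ m ∈ ((Fintype.piFinset fun _ : Fin s => Finset.Icc (-(N : ℤ) + 1) ((N : ℤ) - 1)).filter
      (fun m => m ≠ 0 ∧ (∑ j : Fin s, m j * z ((j : ℕ) + 1)) % (N : ℤ) = 0)).filter (fun m => msupp m = u),
      ∏ j ∈ Finset.univ.filter (fun j => m j ≠ 0), 1 / |(m j : ℝ)|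
    ≤ (1 / (N:ℝ)) * (Real.log 4 + 2 * (1 + Real.log N)) ^ u.card - Real.log 4 ^ u.card
      + (1 / (N:ℝ)) * (2 * u.card * (1 + 2 * Real.log N) ^ u.card * (1 + Real.log N))
      + (1 / (N:ℝ)) * ∑ k ∈ Icc 1 (N-1), ∏ j ∈ u, lsin ((k:ℝ) * z j / N) := by
  set v : Finset (Fin s) := univ.filter (fun j => (j:ℕ) + 1 ∈ u) with hv
  have hinj : Set.InjOn (fun j : Fin s => (j:ℕ) + 1) (v : Set (Fin s)) := by
    intro a _ b _ hab
    simp only at hab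
    exact Fin.ext (by omega)
  have himg : v.image (fun j : Fin s => (j:ℕ) + 1) = u := by
    ext i
    simp only [hv, mem_image, mem_filter, mem_univ, true_and]
    constructor
    · rintro ⟨a, ha, rfl⟩; exact ha
    · intro hi
      have := mem_Icc.1 (hu hi)
      have e : i - 1 + 1 = i := by omega
      exact ⟨⟨i - 1, by omega⟩, by simpa [e] using hi, e⟩
  have hcard : v.card = u.card := by rw [← himg, card_image_of_injOn hinj]
  have hprod : ∀ f : ℕ → ℝ, ∏ j ∈ v, f ((j:ℕ) + 1) = ∏ j ∈ u, f j := by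
    intro f
    rw [← himg, prod_image hinj]
  have hc := count N hN v (fun j : Fin s => z ((j:ℕ) + 1))
  have hsupp : ∀ m : Fin s → ℤ, msupp m = u → univ.filter (fun j => m j ≠ 0) = v := by
    intro m hm
    ext j
    simp only [hv, mem_filter, mem_univ, true_and, ← hm, msupp, mem_image]
    constructor
    · intro h; exact ⟨j, h, rfl⟩
    · rintro ⟨a, ha, hab⟩
      have : a = j := Fin.ext (by omega)
      exact this ▸ ha
  set D := (Fintype.piFinset fun _ : Fin s => Finset.Icc (-(N : ℤ) + 1) ((N : ℤ) - 1)).filter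
      (fun m => (∑ j : Fin s, m j * z ((j:ℕ) + 1)) % (N : ℤ) = 0) with hD
  set G := ((Fintype.piFinset fun _ : Fin s => Finset.Icc (-(N : ℤ) + 1) ((N : ℤ) - 1)).filter
      (fun m => m ≠ 0 ∧ (∑ j : Fin s, m j * z ((j : ℕ) + 1)) % (N : ℤ) = 0)).filter (fun m => msupp m = u) with hG
  have h0G : (0 : Fin s → ℤ) ∉ G := by simp [hG]
  have hsub : insert 0 G ⊆ D := by
    intro m hm
    rw [mem_insert] at hm
    rcases hm with rfl | hm
    · simp only [hD, mem_filter, Fintype.mem_piFinset, mem_Icc, Pi.zero_apply, zero_mul, sum_const_zero, Int.zero_emod,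
        and_true]
      intro _; omega
    · rw [hG, mem_filter, mem_filter] at hm
      rw [hD, mem_filter]
      exact ⟨hm.1.1, hm.1.2.2⟩
  have hle : ∑ m ∈ insert 0 G, ∏ j, auxB v j (m j) ≤ ∑ m ∈ D, ∏ j, auxB v j (m j) :=
    sum_le_sum_of_subset_of_nonneg hsub (fun m _ _ => prod_nonneg fun j _ => auxB_nonneg _ _ _)
  rw [sum_insert h0G, hc] at hle
  have hz0 : ∏ j, auxB v j ((0 : Fin s → ℤ) j) = Real.log 4 ^ u.card := by
    simp only [auxB, auxb, Pi.zero_apply, if_true]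
    rw [prod_ite_mem, univ_inter, prod_const, hcard]
  have hGs : ∑ m ∈ G, ∏ j, auxB v j (m j)
      = ∑ m ∈ G, ∏ j ∈ Finset.univ.filter (fun j => m j ≠ 0), 1 / |(m j : ℝ)| := by
    apply sum_congr rfl
    intro m hm
    have hm' := hsupp m (mem_filter.1 hm).2
    rw [hm', ← univ_inter v, ← prod_ite_mem]
    apply prod_congr rfl
    intro j _
    unfold auxB
    have : j ∈ v ↔ m j ≠ 0 := by rw [← hm']; simp
    by_cases h : m j = 0
    · have hj : j ∉ v := by rw [this]; simpa using h
      simp [hj, h]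
    · have hj : j ∈ v := this.2 h
      simp [hj, h, auxb]
  rw [hz0, hGs] at hle
  have hrange : ∑ k ∈ range N, ∏ j ∈ v, auxA N ((k:ℝ) * z ((j:ℕ) + 1) / N)
      = auxA N 0 ^ u.card + ∑ k ∈ Icc 1 (N-1), ∏ j ∈ u, auxA N ((k:ℝ) * z j / N) := by
    have : range N = insert 0 (Icc 1 (N-1)) := by
      ext k; simp only [mem_range, mem_insert, mem_Icc]; omega
    rw [this, sum_insert (by simp)]
    congr 1
    · simp [prod_const, hcard]
    · apply sum_congr rfl
      intro k _
      exact hprod (fun i => auxA N ((k:ℝ) * z i / N))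
  rw [hrange] at hle
  have h1 := sum_diff N hN z u hz
  have h2 := auxA_zero N hN
  have h3 := pow_le_pow_left₀ h2.1 h2.2 u.card
  have hN0 : (0:ℝ) ≤ 1 / N := by positivity
  have h4 := mul_le_mul_of_nonneg_left (add_le_add h3 h1) hN0
  linarith

/-- Theorem 2: for `N = 2^n`, `n ≥ 1`, strictly positive weights `γ`
and `z ∈ {1,…,N-1}^s` with `gcd(z_j, N) = 1` for `1 ≤ j ≤ s`, the bound on
`T_{1,γ}(N,z)` in terms of `H_{s,n,γ}(z)` holds. -/
theorem statement1 (n : ℕ) (hn : 1 ≤ n) (s : ℕ) (hs : 1 ≤ s)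
    (γ : Finset ℕ → ℝ) (hγpos : ∀ u, 0 < γ u) (hγempty : γ ∅ = 1)
    (z : ℕ → ℤ) (hzrange : ∀ j ∈ Finset.Icc 1 s, 1 ≤ z j ∧ z j ≤ 2 ^ n - 1)
    (hgcd : ∀ j ∈ Finset.Icc 1 s, Int.gcd (z j) ((2 : ℤ) ^ n) = 1) :
    Tsum 1 γ (2 ^ n) s z ≤
      (∑ u ∈ (Finset.Icc 1 s).powerset.filter (· ≠ ∅),
          γ u / 2 ^ n * (Real.log 4 + 2 * (1 + Real.log (2 ^ n))) ^ u.card)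
      - (∑ u ∈ (Finset.Icc 1 s).powerset.filter (· ≠ ∅),
          γ u * Real.log 4 ^ u.card)
      + (∑ u ∈ (Finset.Icc 1 s).powerset.filter (· ≠ ∅),
          γ u / 2 ^ n * (2 * u.card) * (1 + 2 * Real.log (2 ^ n)) ^ u.card
            * (1 + Real.log (2 ^ n)))
      + (1 / 2 ^ n) * Hsum γ s n z := by
  have hN : 1 ≤ 2 ^ n := Nat.one_le_two_pow
  have hcop : ∀ j ∈ Icc 1 s, IsCoprime (z j) ((2 ^ n : ℕ) : ℤ) := by
    intro j hj
    rw [Int.isCoprime_iff_gcd_eq_one]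
    have := hgcd j hj
    push_cast
    exact this
  have hT : Tsum 1 γ (2 ^ n) s z = ∑ u ∈ (Finset.Icc 1 s).powerset.filter (· ≠ ∅), γ u *
      ∑ m ∈ ((Fintype.piFinset fun _ : Fin s => Finset.Icc (-((2 ^ n : ℕ) : ℤ) + 1) (((2 ^ n : ℕ) : ℤ) - 1)).filter
      (fun m => m ≠ 0 ∧ (∑ j : Fin s, m j * z ((j : ℕ) + 1)) % ((2 ^ n : ℕ) : ℤ) = 0)).filter (fun m => msupp m = u),
      ∏ j ∈ Finset.univ.filter (fun j => m j ≠ 0), 1 / |(m j : ℝ)| := by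
    unfold Tsum
    rw [← sum_fiberwise_of_maps_to (g := fun m => msupp m) (t := (Finset.Icc 1 s).powerset.filter (· ≠ ∅))]
    · apply sum_congr rfl
      intro u _
      rw [mul_sum]
      apply sum_congr rfl
      intro m hm
      have hm' := (mem_filter.1 hm).2
      unfold rweight
      rw [hm']
      simp only [Real.rpow_one]
      rw [one_div, mul_inv, inv_inv, ← prod_inv_distrib]
      simp only [one_div]
    · intro m hm
      have hm0 := (mem_filter.1 hm).2.1
      rw [mem_filter, mem_powerset]
      constructor
      · intro i hi
        unfold msupp at hi
        obtain ⟨a, _, rfl⟩ := mem_image.1 hi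
        rw [mem_Icc]
        have := a.2
        omega
      · obtain ⟨j, hj⟩ := Function.ne_iff.1 hm0
        apply Nonempty.ne_empty
        exact ⟨(j:ℕ) + 1, mem_image.2 ⟨j, by simpa using hj, rfl⟩⟩
  have hH : Hsum γ s n z = ∑ u ∈ (Finset.Icc 1 s).powerset.filter (· ≠ ∅), γ u *
      ∑ k ∈ Finset.Icc (1:ℕ) (2 ^ n - 1), ∏ j ∈ u, lsin ((k : ℝ) * (z j : ℝ) / 2 ^ n) := by
    unfold Hsum
    rw [sum_comm]
    simp only [mul_sum]
  rw [hT, hH, mul_sum, ← sum_sub_distrib, ← sum_add_distrib, ← sum_add_distrib]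
  apply sum_le_sum
  intro u hu
  rw [mem_filter, mem_powerset] at hu
  have h := mul_le_mul_of_nonneg_left
    (per_u (2 ^ n) hN s z u hu.1 hu.2 (fun j hj => hcop j (hu.1 hj))) (hγpos u).le
  refine h.trans (le_of_eq ?_)
  push_cast
  ring

end
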